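/- Noether's second theorem, inverse part (Theorem 0510): let L ∈ R be a Lagrangian and let Δ = (Δ^{i,Λ}_r) be a finitely supported family of elements of R satisfying the Noether identity Σ_{i,Λ} Δ^{i,Λ}_r · d_Λ(E_i(L)) = 0 in R for every r ∈ ρ. Then the family υ^{i,Ξ}_r := Σ_{Σ∈M} (−1)^{|Σ+Ξ|} · C(Σ+Ξ,Σ) · d_Σ(Δ^{i,Σ+Ξ}_r), where C(Λ,Σ) := ∏_λ Nat.choose (Λ(λ)) (Σ(λ)), is a gauge symmetry of L, i.e. Σ_{i,r,Ξ} ι̂(υ^{i,Ξ}_r) · ξ^r_Ξ · ι̂(E_i(L)) is a total divergence in R'. -/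

import Mathlib

/-- Size `|Λ|` of a multi-index. -/
def msize {n : ℕ} (Λ : Fin n →₀ ℕ) : ℕ := ∑ i, Λ i

/-- Multi-index binomial coefficient `C(Λ, T) = ∏ λ, choose (Λ λ) (T λ)`. -/
def mchoose {n : ℕ} (Λ T : Fin n →₀ ℕ) : ℕ := ∏ i, (Λ i).choose (T i)

/-- Iterated derivative `d_Λ = ∏ λ (d λ)^[Λ λ]` (well defined for commuting `d λ`). -/
def dIter {R : Type*} {n : ℕ} (d : Fin n → R → R) (Λ : Fin n →₀ ℕ) : R → R :=
  (List.finRange n).foldr (fun i acc => (d i)^[Λ i] ∘ acc) id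

/-- The total derivative `d_λ` on `MvPolynomial (τ × M) k`, the unique `k`-derivation
with `d_λ (X (j, Λ)) = X (j, Λ + e_λ)`. -/
noncomputable def totalDeriv (k : Type*) [CommRing k] {n : ℕ} (τ : Type*) (l : Fin n) :
    Derivation k (MvPolynomial (τ × (Fin n →₀ ℕ)) k) (MvPolynomial (τ × (Fin n →₀ ℕ)) k) :=
  MvPolynomial.mkDerivation k fun p => MvPolynomial.X (p.1, p.2 + Finsupp.single l 1)

/-- The Euler–Lagrange derivative `E_i (L) = ∑_Λ (-1)^{|Λ|} d_Λ (∂_{(i,Λ)} L)`. -/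
noncomputable def EL (k : Type*) [CommRing k] {n : ℕ} (ι : Type*) (i : ι)
    (L : MvPolynomial (ι × (Fin n →₀ ℕ)) k) : MvPolynomial (ι × (Fin n →₀ ℕ)) k :=
  ∑ᶠ Λ : Fin n →₀ ℕ, (-1 : MvPolynomial (ι × (Fin n →₀ ℕ)) k) ^ msize Λ *
    dIter (fun l => ⇑(totalDeriv k ι l)) Λ (MvPolynomial.pderiv (i, Λ) L)

/-- The `k`-algebra embedding `ι̂ : R → R'` induced by `(i, Λ) ↦ (Sum.inl i, Λ)`. -/
noncomputable def fieldEmb (k : Type*) [CommRing k] {n : ℕ} (ι ρ : Type*) :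
    MvPolynomial (ι × (Fin n →₀ ℕ)) k →ₐ[k] MvPolynomial ((ι ⊕ ρ) × (Fin n →₀ ℕ)) k :=
  MvPolynomial.rename fun p => (Sum.inl p.1, p.2)

/-- An element of `MvPolynomial (τ × M) k` is a total divergence if it equals
`∑_λ d_λ (σ^λ)` for some `σ^λ`. -/
def IsTotalDiv (k : Type*) [CommRing k] {n : ℕ} {τ : Type*}
    (f : MvPolynomial (τ × (Fin n →₀ ℕ)) k) : Prop :=
  ∃ σ : Fin n → MvPolynomial (τ × (Fin n →₀ ℕ)) k, f = ∑ l, totalDeriv k τ l (σ l)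

/-- A finitely supported family `υ = (υ^{i,Ξ}_r)` is a gauge symmetry of `L` if
`∑_{i,r,Ξ} ι̂(υ^{i,Ξ}_r) ξ^r_Ξ ι̂(E_i(L))` is a total divergence in `R'`. -/
def IsGaugeSymmetry (k : Type*) [CommRing k] {n : ℕ} (ι ρ : Type*)
    (υ : ι → ρ → (Fin n →₀ ℕ) → MvPolynomial (ι × (Fin n →₀ ℕ)) k)
    (L : MvPolynomial (ι × (Fin n →₀ ℕ)) k) : Prop :=
  IsTotalDiv k (∑ᶠ p : ι × ρ × (Fin n →₀ ℕ),
    fieldEmb k ι ρ (υ p.1 p.2.1 p.2.2) * MvPolynomial.X ((Sum.inr p.2.1 : ι ⊕ ρ), p.2.2) *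
      fieldEmb k ι ρ (EL k ι p.1 L))

namespace NoetherAux

open MvPolynomial

theorem foldr_comm {R : Type*} {n : ℕ} (d : Fin n → R → R)
    (hd : ∀ i j f, d i (d j f) = d j (d i f)) (Λ : Fin n →₀ ℕ) (l : Fin n) (ls : List (Fin n))
    (f : R) :
    ls.foldr (fun i acc => (d i)^[Λ i] ∘ acc) id (d l f) =
      d l (ls.foldr (fun i acc => (d i)^[Λ i] ∘ acc) id f) := by
  induction ls with
  | nil => rfl
  | cons a t ih =>
    simp only [List.foldr_cons, Function.comp_apply, ih]
    exact (Function.Commute.iterate_left (fun x => hd a l x) (Λ a)) _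

theorem foldr_notMem {R : Type*} {n : ℕ} (d : Fin n → R → R)
    (Λ : Fin n →₀ ℕ) (l : Fin n) (ls : List (Fin n)) (hl : l ∉ ls) (f : R) :
    ls.foldr (fun i acc => (d i)^[(Λ + Finsupp.single l 1 : Fin n →₀ ℕ) i] ∘ acc) id f =
      ls.foldr (fun i acc => (d i)^[Λ i] ∘ acc) id f := by
  induction ls with
  | nil => rfl
  | cons a t ih =>
    rw [List.mem_cons, not_or] at hl
    simp only [List.foldr_cons, Function.comp_apply, ih hl.2]
    have : (Λ + Finsupp.single l 1 : Fin n →₀ ℕ) a = Λ a := by simp [Finsupp.single_apply, hl.1]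
    rw [this]

theorem foldr_mem {R : Type*} {n : ℕ} (d : Fin n → R → R)
    (hd : ∀ i j f, d i (d j f) = d j (d i f))
    (Λ : Fin n →₀ ℕ) (l : Fin n) (ls : List (Fin n)) (hn : ls.Nodup) (hl : l ∈ ls) (f : R) :
    ls.foldr (fun i acc => (d i)^[(Λ + Finsupp.single l 1 : Fin n →₀ ℕ) i] ∘ acc) id f =
      d l (ls.foldr (fun i acc => (d i)^[Λ i] ∘ acc) id f) := by
  induction ls with
  | nil => simp at hl
  | cons a t ih =>
    rw [List.nodup_cons] at hn
    by_cases h : l = a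
    · subst h
      simp only [List.foldr_cons, Function.comp_apply, foldr_notMem d Λ l t hn.1]
      have : (Λ + Finsupp.single l 1 : Fin n →₀ ℕ) l = Λ l + 1 := by simp
      rw [this, Function.iterate_succ_apply']
    · have hl' : l ∈ t := by simpa [h] using hl
      simp only [List.foldr_cons, Function.comp_apply, ih hn.2 hl']
      have : (Λ + Finsupp.single l 1 : Fin n →₀ ℕ) a = Λ a := by simp [Finsupp.single_apply, h]
      rw [this]
      exact (Function.Commute.iterate_left (fun x => hd a l x) (Λ a)) _

theorem dIter_succ {R : Type*} {n : ℕ} (d : Fin n → R → R)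
    (hd : ∀ i j f, d i (d j f) = d j (d i f)) (Λ : Fin n →₀ ℕ) (l : Fin n) (f : R) :
    dIter d (Λ + Finsupp.single l 1) f = d l (dIter d Λ f) :=
  foldr_mem d hd Λ l _ (List.nodup_finRange n) (List.mem_finRange l) f

theorem dIter_comm {R : Type*} {n : ℕ} (d : Fin n → R → R)
    (hd : ∀ i j f, d i (d j f) = d j (d i f)) (Λ : Fin n →₀ ℕ) (l : Fin n) (f : R) :
    dIter d Λ (d l f) = d l (dIter d Λ f) :=
  foldr_comm d hd Λ l _ f

theorem dIter_zero {R : Type*} {n : ℕ} (d : Fin n → R → R) (f : R) :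
    dIter d 0 f = f := by
  unfold dIter
  induction List.finRange n with
  | nil => rfl
  | cons a t ih => simpa using ih

theorem mindex_induction {n : ℕ} {P : (Fin n →₀ ℕ) → Prop} (h0 : P 0)
    (hs : ∀ Λ l, P Λ → P (Λ + Finsupp.single l 1)) (Λ : Fin n →₀ ℕ) : P Λ := by
  have key : ∀ Γ, P Γ → P (Γ + Λ) := by
    induction Λ using Finsupp.induction_linear with
    | zero => intro Γ h; simpa using h
    | add f g hf hg => intro Γ h; rw [← add_assoc]; exact hg _ (hf _ h)
    | single l b =>
      induction b with
      | zero => intro Γ h; simpa using h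
      | succ b ih =>
        intro Γ h
        rw [Finsupp.single_add, ← add_assoc]
        exact hs _ _ (ih _ h)
  simpa using key 0 h0

theorem msize_zero {n : ℕ} : msize (0 : Fin n →₀ ℕ) = 0 := by simp [msize]

theorem msize_succ {n : ℕ} (Λ : Fin n →₀ ℕ) (l : Fin n) :
    msize (Λ + Finsupp.single l 1) = msize Λ + 1 := by
  simp [msize, Finset.sum_add_distrib, Finsupp.single_apply]

theorem mchoose_eq_zero {n : ℕ} (Λ T : Fin n →₀ ℕ) (h : ¬ T ≤ Λ) : mchoose Λ T = 0 := by
  rw [Finsupp.le_def] at h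
  push Not at h
  obtain ⟨i, hi⟩ := h
  exact Finset.prod_eq_zero (Finset.mem_univ i) (Nat.choose_eq_zero_of_lt hi)

theorem mchoose_zero_right {n : ℕ} (Λ : Fin n →₀ ℕ) : mchoose Λ 0 = 1 := by simp [mchoose]

/-- Pascal's rule, case where the component of `T` vanishes. -/
theorem mchoose_pascal_zero {n : ℕ} (Λ T : Fin n →₀ ℕ) (l : Fin n) (h : T l = 0) :
    mchoose (Λ + Finsupp.single l 1) T = mchoose Λ T := by
  unfold mchoose
  refine Finset.prod_congr rfl fun i _ => ?_
  by_cases hi : l = i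
  · subst hi; simp [h]
  · simp [Finsupp.single_apply, hi]

/-- Pascal's rule, case of a positive component. -/
theorem mchoose_pascal_succ {n : ℕ} (Λ T : Fin n →₀ ℕ) (l : Fin n) :
    mchoose (Λ + Finsupp.single l 1) (T + Finsupp.single l 1) =
      mchoose Λ T + mchoose Λ (T + Finsupp.single l 1) := by
  unfold mchoose
  rw [← Finset.mul_prod_erase _ _ (Finset.mem_univ l),
    ← Finset.mul_prod_erase _ (fun i => (Λ i).choose (T i)) (Finset.mem_univ l),
    ← Finset.mul_prod_erase _ (fun i => (Λ i).choose ((T + Finsupp.single l 1 : Fin n →₀ ℕ) i)) (Finset.mem_univ l)]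
  have e1 : ∏ i ∈ Finset.univ.erase l,
      ((Λ + Finsupp.single l 1 : Fin n →₀ ℕ) i).choose ((T + Finsupp.single l 1 : Fin n →₀ ℕ) i) =
      ∏ i ∈ Finset.univ.erase l, (Λ i).choose (T i) := by
    refine Finset.prod_congr rfl fun i hi => ?_
    have : l ≠ i := fun h => (Finset.ne_of_mem_erase hi) h.symm
    simp [Finsupp.single_apply, this]
  have e2 : ∏ i ∈ Finset.univ.erase l,
      (Λ i).choose ((T + Finsupp.single l 1 : Fin n →₀ ℕ) i) =
      ∏ i ∈ Finset.univ.erase l, (Λ i).choose (T i) := by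
    refine Finset.prod_congr rfl fun i hi => ?_
    have : l ≠ i := fun h => (Finset.ne_of_mem_erase hi) h.symm
    simp [Finsupp.single_apply, this]
  rw [e1, e2, ← add_mul]
  simp [Nat.choose_succ_succ]

theorem sub_single_add {n : ℕ} (T : Fin n →₀ ℕ) (l : Fin n) (h : T l ≠ 0) :
    T - Finsupp.single l 1 + Finsupp.single l 1 = T := by
  apply tsub_add_cancel_of_le
  rw [Finsupp.single_le_iff]
  omega

theorem antidiag_pascal {n : ℕ} {A : Type*} [CommRing A] (Λ : Fin n →₀ ℕ) (l : Fin n)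
    (F : (Fin n →₀ ℕ) → (Fin n →₀ ℕ) → A) :
    ∑ p ∈ Finset.HasAntidiagonal.antidiagonal (Λ + Finsupp.single l 1),
        (mchoose (Λ + Finsupp.single l 1) p.1 : A) * F p.1 p.2 =
      ∑ p ∈ Finset.HasAntidiagonal.antidiagonal Λ, (mchoose Λ p.1 : A) *
        (F (p.1 + Finsupp.single l 1) p.2 + F p.1 (p.2 + Finsupp.single l 1)) := by
  classical
  have h1 : ∑ p ∈ Finset.HasAntidiagonal.antidiagonal Λ, (mchoose Λ p.1 : A) * F p.1 (p.2 + Finsupp.single l 1) =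
      ∑ p ∈ Finset.HasAntidiagonal.antidiagonal (Λ + Finsupp.single l 1), (mchoose Λ p.1 : A) * F p.1 p.2 := by
    refine Finset.sum_of_injOn (fun p => (p.1, p.2 + Finsupp.single l 1)) ?_ ?_ ?_ ?_
    · rintro ⟨a, b⟩ _ ⟨c, e⟩ _ h
      simpa using h
    · rintro ⟨a, b⟩ h
      simp only [Finset.mem_coe, Finset.HasAntidiagonal.mem_antidiagonal] at h ⊢
      rw [← h, add_assoc]
    · rintro ⟨a, b⟩ h h'
      simp only [Finset.HasAntidiagonal.mem_antidiagonal] at h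
      rw [mchoose_eq_zero, Nat.cast_zero, zero_mul]
      intro hle
      apply h'
      refine ⟨(a, Λ - a), ?_, ?_⟩
      · simp [add_tsub_cancel_of_le hle]
      · simp only [Prod.mk.injEq, true_and]
        apply add_left_cancel (a := a)
        rw [h, ← add_assoc, add_tsub_cancel_of_le hle]
    · intro p _; rfl
  have h2 : ∑ p ∈ Finset.HasAntidiagonal.antidiagonal Λ, (mchoose Λ p.1 : A) * F (p.1 + Finsupp.single l 1) p.2 =
      ∑ p ∈ Finset.HasAntidiagonal.antidiagonal (Λ + Finsupp.single l 1),
        (if (p.1 : Fin n →₀ ℕ) l = 0 then 0 else (mchoose Λ (p.1 - Finsupp.single l 1) : A)) * F p.1 p.2 := by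
    refine Finset.sum_of_injOn (fun p => (p.1 + Finsupp.single l 1, p.2)) ?_ ?_ ?_ ?_
    · rintro ⟨a, b⟩ _ ⟨c, e⟩ _ h
      simpa using h
    · rintro ⟨a, b⟩ h
      simp only [Finset.mem_coe, Finset.HasAntidiagonal.mem_antidiagonal] at h ⊢
      rw [← h, add_right_comm]
    · rintro ⟨a, b⟩ h h'
      simp only [Finset.HasAntidiagonal.mem_antidiagonal] at h
      by_cases ha : a l = 0
      · simp [ha]
      · exfalso
        apply h'
        refine ⟨(a - Finsupp.single l 1, b), ?_, ?_⟩
        · simp only [Finset.mem_coe, Finset.HasAntidiagonal.mem_antidiagonal]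
          apply add_right_cancel (b := Finsupp.single l 1)
          rw [add_right_comm, sub_single_add _ _ ha, h]
        · simp [sub_single_add _ _ ha]
    · intro p _; simp
  simp only [mul_add, Finset.sum_add_distrib]
  rw [h1, h2, ← Finset.sum_add_distrib]
  refine Finset.sum_congr rfl fun p _ => ?_
  rw [← add_mul]
  congr 1
  by_cases ha : p.1 l = 0
  · simp [ha, mchoose_pascal_zero]
  · have := mchoose_pascal_succ Λ (p.1 - Finsupp.single l 1) l
    rw [sub_single_add _ _ ha] at this
    simp [ha, this]

section deriv

variable {k : Type*} [CommRing k] {n : ℕ} {τ : Type*}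

theorem totalDeriv_X (l : Fin n) (p : τ × (Fin n →₀ ℕ)) :
    totalDeriv k τ l (X p) = X (p.1, p.2 + Finsupp.single l 1) := by
  simp [totalDeriv, mkDerivation_X]

theorem totalDeriv_comm (i j : Fin n) (f : MvPolynomial (τ × (Fin n →₀ ℕ)) k) :
    totalDeriv k τ i (totalDeriv k τ j f) = totalDeriv k τ j (totalDeriv k τ i f) := by
  have h : ⁅totalDeriv k τ i, totalDeriv k τ j⁆ = 0 := by
    apply MvPolynomial.derivation_ext
    intro p
    rw [Derivation.commutator_apply]
    simp only [totalDeriv_X, Derivation.zero_apply, add_right_comm, sub_self]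
  have := congrArg (fun D => D f) h
  simpa [Derivation.commutator_apply, sub_eq_zero] using this

/-- Iterated total derivative. -/
noncomputable abbrev DD (k : Type*) [CommRing k] {n : ℕ} (τ : Type*) (Λ : Fin n →₀ ℕ) :
    MvPolynomial (τ × (Fin n →₀ ℕ)) k → MvPolynomial (τ × (Fin n →₀ ℕ)) k :=
  dIter (fun l => ⇑(totalDeriv k τ l)) Λ

theorem DD_zero (f : MvPolynomial (τ × (Fin n →₀ ℕ)) k) : DD k τ 0 f = f := dIter_zero _ f

theorem DD_succ (Λ : Fin n →₀ ℕ) (l : Fin n) (f : MvPolynomial (τ × (Fin n →₀ ℕ)) k) :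
    DD k τ (Λ + Finsupp.single l 1) f = totalDeriv k τ l (DD k τ Λ f) :=
  dIter_succ _ totalDeriv_comm Λ l f

theorem DD_comm (Λ : Fin n →₀ ℕ) (l : Fin n) (f : MvPolynomial (τ × (Fin n →₀ ℕ)) k) :
    DD k τ Λ (totalDeriv k τ l f) = totalDeriv k τ l (DD k τ Λ f) :=
  dIter_comm _ totalDeriv_comm Λ l f

theorem DD_map_zero (Λ : Fin n →₀ ℕ) : DD k τ Λ 0 = 0 := by
  induction Λ using mindex_induction with
  | h0 => exact DD_zero _
  | hs Λ l ih => rw [DD_succ, ih, map_zero]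

theorem DD_X (j : τ) (Λ : Fin n →₀ ℕ) :
    DD k τ Λ (X (j, 0)) = X (j, Λ) := by
  induction Λ using mindex_induction with
  | h0 => exact DD_zero _
  | hs Λ l ih => rw [DD_succ, ih, totalDeriv_X]

theorem DD_mul (Λ : Fin n →₀ ℕ) (f g : MvPolynomial (τ × (Fin n →₀ ℕ)) k) :
    DD k τ Λ (f * g) = ∑ p ∈ Finset.HasAntidiagonal.antidiagonal Λ,
      (mchoose Λ p.1 : MvPolynomial (τ × (Fin n →₀ ℕ)) k) * (DD k τ p.1 f * DD k τ p.2 g) := by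
  induction Λ using mindex_induction with
  | h0 => simp [DD_zero, mchoose_zero_right]
  | hs Λ l ih =>
    rw [DD_succ, ih, antidiag_pascal Λ l (fun a b => DD k τ a f * DD k τ b g), map_sum]
    refine Finset.sum_congr rfl fun p _ => ?_
    rw [DD_succ, DD_succ, Derivation.leibniz, Derivation.leibniz, Derivation.map_natCast]
    simp only [smul_eq_mul]
    ring

theorem isTotalDiv_zero : IsTotalDiv k (0 : MvPolynomial (τ × (Fin n →₀ ℕ)) k) :=
  ⟨0, by simp⟩

theorem IsTotalDiv.add' {f g : MvPolynomial (τ × (Fin n →₀ ℕ)) k}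
    (hf : IsTotalDiv k f) (hg : IsTotalDiv k g) : IsTotalDiv k (f + g) := by
  obtain ⟨a, rfl⟩ := hf
  obtain ⟨b, rfl⟩ := hg
  exact ⟨a + b, by simp [Finset.sum_add_distrib]⟩

theorem IsTotalDiv.sum' {α : Type*} (s : Finset α) (f : α → MvPolynomial (τ × (Fin n →₀ ℕ)) k)
    (h : ∀ a ∈ s, IsTotalDiv k (f a)) : IsTotalDiv k (∑ a ∈ s, f a) :=
  Finset.sum_induction _ _ (fun _ _ => IsTotalDiv.add') isTotalDiv_zero h

theorem isTotalDiv_deriv (l : Fin n) (f : MvPolynomial (τ × (Fin n →₀ ℕ)) k) :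
    IsTotalDiv k (totalDeriv k τ l f) := by
  classical
  refine ⟨Pi.single l f, ?_⟩
  rw [Finset.sum_eq_single l]
  · simp
  · intro b _ hb
    simp [hb]
  · simp

/-- Integration by parts. -/
theorem isTotalDiv_ibp (Λ : Fin n →₀ ℕ) (f g : MvPolynomial (τ × (Fin n →₀ ℕ)) k) :
    IsTotalDiv k ((-1) ^ msize Λ * (DD k τ Λ f * g) - f * DD k τ Λ g) := by
  induction Λ using mindex_induction generalizing g with
  | h0 => simpa [DD_zero, msize_zero] using isTotalDiv_zero
  | hs Λ l ih =>
    have h := IsTotalDiv.add' (isTotalDiv_deriv l ((-1) ^ (msize Λ + 1) * (DD k τ Λ f * g)))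
      (ih (totalDeriv k τ l g))
    convert h using 1
    have hc : totalDeriv k τ l ((-1 : MvPolynomial (τ × (Fin n →₀ ℕ)) k) ^ (msize Λ + 1)) = 0 := by
      rw [Derivation.leibniz_pow]; simp
    rw [Derivation.leibniz, hc, Derivation.leibniz, DD_succ, DD_succ, DD_comm, msize_succ]
    simp only [smul_eq_mul]
    ring

theorem fieldEmb_deriv {ι ρ : Type*} (l : Fin n) (f : MvPolynomial (ι × (Fin n →₀ ℕ)) k) :
    fieldEmb k ι ρ (totalDeriv k ι l f) = totalDeriv k (ι ⊕ ρ) l (fieldEmb k ι ρ f) := by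
  induction f using MvPolynomial.induction_on with
  | C a =>
    have : (C a : MvPolynomial (ι × (Fin n →₀ ℕ)) k) = algebraMap k _ a := rfl
    rw [this]; simp
  | add p q hp hq => simp [hp, hq]
  | mul_X p q hp =>
    simp only [Derivation.leibniz, map_add, map_mul, smul_eq_mul, hp, totalDeriv_X]
    simp [fieldEmb, totalDeriv_X]

theorem fieldEmb_DD {ι ρ : Type*} (Λ : Fin n →₀ ℕ) (f : MvPolynomial (ι × (Fin n →₀ ℕ)) k) :
    fieldEmb k ι ρ (DD k ι Λ f) = DD k (ι ⊕ ρ) Λ (fieldEmb k ι ρ f) := by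
  induction Λ using mindex_induction with
  | h0 => rw [DD_zero, DD_zero]
  | hs Λ l ih => rw [DD_succ, DD_succ, fieldEmb_deriv, ih]

end deriv

theorem sum_reindex {n : ℕ} {A : Type*} [AddCommMonoid A] (W : Finset (Fin n →₀ ℕ))
    (hW : ∀ a b, a + b ∈ W → a ∈ W ∧ b ∈ W) (H : (Fin n →₀ ℕ) → (Fin n →₀ ℕ) → A)
    (hH : ∀ a b, a + b ∉ W → H a b = 0) :
    ∑ b ∈ W, ∑ a ∈ W, H a b = ∑ Λ ∈ W, ∑ p ∈ Finset.HasAntidiagonal.antidiagonal Λ, H p.1 p.2 := by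
  classical
  rw [← Finset.sum_product', Finset.sum_sigma']
  symm
  refine Finset.sum_of_injOn (fun x => (x.2.2, x.2.1)) ?_ ?_ ?_ ?_
  · rintro ⟨c, a, b⟩ h ⟨c', a', b'⟩ h' he
    simp only [Finset.coe_sigma, Set.mem_sigma_iff, Finset.mem_coe, Finset.HasAntidiagonal.mem_antidiagonal] at h h'
    simp only [Prod.mk.injEq] at he
    obtain ⟨rfl, rfl⟩ := he
    obtain ⟨_, rfl⟩ := h
    obtain ⟨_, rfl⟩ := h'
    rfl
  · rintro ⟨c, a, b⟩ h
    simp only [Finset.coe_sigma, Set.mem_sigma_iff, Finset.mem_coe, Finset.HasAntidiagonal.mem_antidiagonal] at h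
    obtain ⟨h, rfl⟩ := h
    have := hW a b h
    simp [this.1, this.2]
  · rintro ⟨b, a⟩ _ h'
    apply hH
    intro h
    apply h'
    exact ⟨⟨a + b, a, b⟩, by simp [h], rfl⟩
  · intro x _; rfl

end NoetherAux
open NoetherAux

/-- Noether's second theorem, inverse part (Theorem 0510): if a finitely supported
family `Δ` satisfies the Noether identity `∑_{i,Λ} Δ^{i,Λ}_r d_Λ (E_i(L)) = 0` for
every `r`, then `υ^{i,Ξ}_r = ∑_T (-1)^{|T+Ξ|} C(T+Ξ,T) d_T (Δ^{i,T+Ξ}_r)` is a gauge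
symmetry of `L`. -/
theorem noether_second_inverse (k : Type*) [CommRing k] (n : ℕ) (hn : 1 ≤ n)
    (ι ρ : Type*) (L : MvPolynomial (ι × (Fin n →₀ ℕ)) k)
    (Δ : ι → ρ → (Fin n →₀ ℕ) → MvPolynomial (ι × (Fin n →₀ ℕ)) k)
    (hΔ : (Function.support fun p : ι × ρ × (Fin n →₀ ℕ) => Δ p.1 p.2.1 p.2.2).Finite)
    (hNoether : ∀ r : ρ,
      ∑ᶠ p : ι × (Fin n →₀ ℕ),
        Δ p.1 r p.2 * dIter (fun l => ⇑(totalDeriv k ι l)) p.2 (EL k ι p.1 L) = 0) :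
    IsGaugeSymmetry k ι ρ
      (fun i r Ξ => ∑ᶠ T : Fin n →₀ ℕ,
        (-1 : MvPolynomial (ι × (Fin n →₀ ℕ)) k) ^ msize (T + Ξ) *
          (mchoose (T + Ξ) T : MvPolynomial (ι × (Fin n →₀ ℕ)) k) *
            dIter (fun l => ⇑(totalDeriv k ι l)) T (Δ i r (T + Ξ))) L := by
  classical
  set S := hΔ.toFinset with hS
  let I : Finset ι := S.image (fun p => p.1)
  let J : Finset ρ := S.image (fun p => p.2.1)
  let W : Finset (Fin n →₀ ℕ) := S.biUnion (fun p => Finset.Iic p.2.2)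
  have hmem : ∀ i r Λ, Δ i r Λ ≠ 0 → i ∈ I ∧ r ∈ J ∧ Λ ∈ W := by
    intro i r Λ h
    have hs : (i, r, Λ) ∈ S := by simpa [hS] using h
    exact ⟨Finset.mem_image.2 ⟨_, hs, rfl⟩, Finset.mem_image.2 ⟨_, hs, rfl⟩,
      Finset.mem_biUnion.2 ⟨_, hs, by simp⟩⟩
  have hW : ∀ a b, a + b ∈ W → a ∈ W ∧ b ∈ W := by
    intro a b h
    obtain ⟨p, hp, hab⟩ := Finset.mem_biUnion.1 h
    rw [Finset.mem_Iic] at hab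
    exact ⟨Finset.mem_biUnion.2 ⟨p, hp, Finset.mem_Iic.2 (le_self_add.trans hab)⟩,
      Finset.mem_biUnion.2 ⟨p, hp, Finset.mem_Iic.2 (le_add_self.trans hab)⟩⟩
  -- the inner finsum
  have hυ : ∀ i r Ξ, (∑ᶠ T : Fin n →₀ ℕ,
        (-1 : MvPolynomial (ι × (Fin n →₀ ℕ)) k) ^ msize (T + Ξ) *
          (mchoose (T + Ξ) T : MvPolynomial (ι × (Fin n →₀ ℕ)) k) *
            DD k ι T (Δ i r (T + Ξ))) = ∑ T ∈ W,
        (-1 : MvPolynomial (ι × (Fin n →₀ ℕ)) k) ^ msize (T + Ξ) *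
          (mchoose (T + Ξ) T : MvPolynomial (ι × (Fin n →₀ ℕ)) k) *
            DD k ι T (Δ i r (T + Ξ)) := by
    intro i r Ξ
    apply finsum_eq_sum_of_support_subset
    intro T hT
    have : Δ i r (T + Ξ) ≠ 0 := by
      intro h0
      apply hT
      simp only [h0, DD_map_zero, mul_zero]
    exact (hW _ _ (hmem _ _ _ this).2.2).1
  have hυ0 : ∀ i r Ξ, ¬ (i ∈ I ∧ r ∈ J ∧ Ξ ∈ W) → (∑ T ∈ W,
        (-1 : MvPolynomial (ι × (Fin n →₀ ℕ)) k) ^ msize (T + Ξ) *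
          (mchoose (T + Ξ) T : MvPolynomial (ι × (Fin n →₀ ℕ)) k) *
            DD k ι T (Δ i r (T + Ξ))) = 0 := by
    intro i r Ξ h
    refine Finset.sum_eq_zero fun T _ => ?_
    have : Δ i r (T + Ξ) = 0 := by
      by_contra h0
      have h1 := hmem _ _ _ h0
      exact h ⟨h1.1, h1.2.1, (hW _ _ h1.2.2).2⟩
    simp only [this, DD_map_zero, mul_zero]
  unfold IsGaugeSymmetry
  simp only [hυ]
  rw [finsum_eq_sum_of_support_subset (s := I ×ˢ J ×ˢ W)]
  swap
  · rintro ⟨i, r, Ξ⟩ h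
    by_contra h'
    apply h
    have := hυ0 i r Ξ (by simpa using h')
    simp only [this, map_zero, zero_mul]
  rw [Finset.sum_product]
  simp only [Finset.sum_product]
  have hN : ∀ r, ∑ i ∈ I, ∑ Λ ∈ W, Δ i r Λ * DD k ι Λ (EL k ι i L) = 0 := by
    intro r
    rw [← hNoether r, finsum_eq_sum_of_support_subset (s := I ×ˢ W), Finset.sum_product]
    rintro ⟨i, Λ⟩ h
    have : Δ i r Λ ≠ 0 := by
      intro h0
      apply h
      simp only [h0, zero_mul]
    have := hmem _ _ _ this
    simp [this.1, this.2.2]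
  have hmain : ∀ i r, ∑ Ξ ∈ W, fieldEmb k ι ρ (∑ T ∈ W,
        (-1 : MvPolynomial (ι × (Fin n →₀ ℕ)) k) ^ msize (T + Ξ) *
          (mchoose (T + Ξ) T : MvPolynomial (ι × (Fin n →₀ ℕ)) k) *
            DD k ι T (Δ i r (T + Ξ))) * MvPolynomial.X ((Sum.inr r : ι ⊕ ρ), Ξ) *
        fieldEmb k ι ρ (EL k ι i L) =
      ∑ Λ ∈ W, (-1) ^ msize Λ * (DD k (ι ⊕ ρ) Λ (fieldEmb k ι ρ (Δ i r Λ) *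
        MvPolynomial.X ((Sum.inr r : ι ⊕ ρ), 0)) * fieldEmb k ι ρ (EL k ι i L)) := by
    intro i r
    simp only [map_sum, Finset.sum_mul]
    rw [sum_reindex W hW]
    · refine Finset.sum_congr rfl fun Λ _ => ?_
      rw [DD_mul, Finset.sum_mul, Finset.mul_sum]
      refine Finset.sum_congr rfl fun p hp => ?_
      rw [Finset.HasAntidiagonal.mem_antidiagonal] at hp
      rw [hp, DD_X]
      simp only [map_mul, map_pow, map_neg, map_one, map_natCast, fieldEmb_DD]
      ring
    · intro a b hab
      have : Δ i r (a + b) = 0 := by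
        by_contra h0
        exact hab (hmem _ _ _ h0).2.2
      simp only [this, DD_map_zero, mul_zero, map_zero, zero_mul]
  simp only [hmain]
  have hdiv : IsTotalDiv k (∑ i ∈ I, ∑ r ∈ J, ∑ Λ ∈ W,
      ((-1) ^ msize Λ * (DD k (ι ⊕ ρ) Λ (fieldEmb k ι ρ (Δ i r Λ) *
        MvPolynomial.X ((Sum.inr r : ι ⊕ ρ), 0)) * fieldEmb k ι ρ (EL k ι i L)) -
       (fieldEmb k ι ρ (Δ i r Λ) * MvPolynomial.X ((Sum.inr r : ι ⊕ ρ), 0)) *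
        DD k (ι ⊕ ρ) Λ (fieldEmb k ι ρ (EL k ι i L)))) :=
    IsTotalDiv.sum' _ _ fun i _ => IsTotalDiv.sum' _ _ fun r _ => IsTotalDiv.sum' _ _ fun Λ _ =>
      isTotalDiv_ibp Λ _ _
  have hz : ∑ i ∈ I, ∑ r ∈ J, ∑ Λ ∈ W,
       (fieldEmb k ι ρ (Δ i r Λ) * MvPolynomial.X ((Sum.inr r : ι ⊕ ρ), 0)) *
        DD k (ι ⊕ ρ) Λ (fieldEmb k ι ρ (EL k ι i L)) = 0 := by
    rw [Finset.sum_comm]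
    refine Finset.sum_eq_zero fun r _ => ?_
    have h := congrArg (fun f => MvPolynomial.X ((Sum.inr r : ι ⊕ ρ), 0) * fieldEmb k ι ρ f) (hN r)
    simp only [map_sum, map_mul, fieldEmb_DD, map_zero, mul_zero, Finset.mul_sum] at h
    rw [← h]
    refine Finset.sum_congr rfl fun i _ => Finset.sum_congr rfl fun Λ _ => ?_
    ring
  simp only [Finset.sum_sub_distrib] at hdiv
  rw [hz, sub_zero] at hdiv
  exact hdiv
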